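/- Let λ > 0 and let μ satisfy 1 ≤ μ ≤ λ/2. Then ∫_0^μ Φ_{λ,μ}(z) dz + ∫_μ^λ G_λ(z) dz − T(Φ_{λ,μ} + 1/4, 0, ⌊μ⌋) − T(G_λ + 1/4, ⌊μ⌋, ⌊λ⌋+1) > (1/4)(⌊λ/10⌋ − ⌊μ⌋ − 8/(15√μ)). -/

import Mathlib

open Real Set

/-- The trapezoidal floor sum of `g` on `[a,b]`. -/
noncomputable def trapSum (g : ℝ → ℝ) (a b : ℤ) : ℝ :=
  (⌊g a⌋ : ℝ) / 2 + ∑ m ∈ Finset.Ioo a b, (⌊g m⌋ : ℝ) + (⌊g b⌋ : ℝ) / 2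

/-- The function `G_λ(z) = (1/π)(√(λ² − z²) − z·arccos(z/λ))` for `z ≤ λ`, and `0` for `z > λ`. -/
noncomputable def funG (lam z : ℝ) : ℝ :=
  if z ≤ lam then (Real.sqrt (lam ^ 2 - z ^ 2) - z * Real.arccos (z / lam)) / π else 0

/-- The function `Φ_{λ,μ}(z) = G_λ(z) − G_μ(z)`. -/
noncomputable def funPhi (lam mu z : ℝ) : ℝ := funG lam z - funG mu z

lemma sqrt_one_sub_div_sq {l : ℝ} (hl : 0 < l) (z : ℝ) :
    √(1 - (z / l) ^ 2) = √(l ^ 2 - z ^ 2) / l := by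
  have h : 1 - (z / l) ^ 2 = (l ^ 2 - z ^ 2) / l ^ 2 := by field_simp
  rw [h, sqrt_div' _ (sq_nonneg l), sqrt_sq hl.le]

/-- The case distinction in `funG` is redundant: the closed formula vanishes beyond `lam`. -/
lemma funG_eq {lam : ℝ} (hlam : 0 < lam) (z : ℝ) :
    funG lam z = (√(lam ^ 2 - z ^ 2) - z * arccos (z / lam)) / π := by
  unfold funG
  split_ifs with h
  · rfl
  · push Not at h
    have h1 : arccos (z / lam) = 0 := arccos_eq_zero.2 ((one_le_div hlam).2 h.le)
    have h2 : √(lam ^ 2 - z ^ 2) = 0 := sqrt_eq_zero_of_nonpos (by nlinarith)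
    simp [h1, h2]

lemma continuous_funG {lam : ℝ} (hlam : 0 < lam) : Continuous (funG lam) := by
  have h : funG lam = fun z => (√(lam ^ 2 - z ^ 2) - z * arccos (z / lam)) / π :=
    funext (funG_eq hlam)
  rw [h]
  have := continuous_arccos
  fun_prop

lemma funG_of_le {lam z : ℝ} (hlam : 0 < lam) (h : lam ≤ z) : funG lam z = 0 := by
  have h1 : arccos (z / lam) = 0 := arccos_eq_zero.2 ((one_le_div hlam).2 h)
  have h2 : √(lam ^ 2 - z ^ 2) = 0 := sqrt_eq_zero_of_nonpos (by nlinarith)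
  simp [funG_eq hlam, h1, h2]

lemma sin_le_tangent {a t : ℝ} (ha : a ∈ Icc 0 π) (ht : t ∈ Icc 0 π) :
    sin t ≤ sin a + (t - a) * cos a := by
  have hd : ∀ x : ℝ, HasDerivAt (fun x => sin a + (x - a) * cos a - sin x)
      (cos a - cos x) x := by
    intro x
    have := ((((hasDerivAt_id x).sub_const a).mul_const (cos a)).const_add (sin a)).sub
      (hasDerivAt_sin x)
    exact this.congr_deriv (by ring)
  have hc : Continuous (fun x => sin a + (x - a) * cos a - sin x) := by fun_prop
  rcases le_total a t with h | h
  · have hm : MonotoneOn (fun x => sin a + (x - a) * cos a - sin x) (Icc a π) := by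
      apply monotoneOn_of_deriv_nonneg (convex_Icc _ _) hc.continuousOn
        (fun x _ => (hd x).differentiableAt.differentiableWithinAt)
      intro x hx
      rw [interior_Icc] at hx
      rw [(hd x).deriv]
      have := cos_le_cos_of_nonneg_of_le_pi ha.1 hx.2.le hx.1.le
      linarith
    have := hm ⟨le_rfl, ha.2⟩ ⟨h, ht.2⟩ h
    simp at this
    linarith
  · have hm : AntitoneOn (fun x => sin a + (x - a) * cos a - sin x) (Icc 0 a) := by
      apply antitoneOn_of_deriv_nonpos (convex_Icc _ _) hc.continuousOn
        (fun x _ => (hd x).differentiableAt.differentiableWithinAt)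
      intro x hx
      rw [interior_Icc] at hx
      rw [(hd x).deriv]
      have := cos_le_cos_of_nonneg_of_le_pi hx.1.le ha.2 hx.2.le
      linarith
    have := hm ⟨ht.1, h⟩ ⟨ha.1, le_rfl⟩ h
    simp at this
    linarith

/-- `π * funG lam y` dominates the affine functions `lam * sin t - y * t`. -/
lemma le_funG {lam y t : ℝ} (hlam : 0 < lam) (hy : 0 ≤ y) (ht : t ∈ Icc 0 π) :
    (lam * sin t - y * t) / π ≤ funG lam y := by
  rcases le_total lam y with h | h
  · rw [funG_of_le hlam h]
    have h1 := sin_le ht.1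
    have h2 := ht.1
    apply div_nonpos_of_nonpos_of_nonneg _ pi_pos.le
    nlinarith
  · rw [funG_eq hlam]
    apply div_le_div_of_nonneg_right _ pi_pos.le
    have h0 : 0 ≤ y / lam := by positivity
    have h1 : y / lam ≤ 1 := (div_le_one hlam).2 h
    have hs : √(lam ^ 2 - y ^ 2) = lam * sin (arccos (y / lam)) := by
      rw [sin_arccos, sqrt_one_sub_div_sq hlam]
      field_simp
    have hy' : y = lam * cos (arccos (y / lam)) := by
      rw [cos_arccos (by linarith) h1]
      field_simp
    have := sin_le_tangent (a := arccos (y / lam)) ⟨arccos_nonneg _, arccos_le_pi _⟩ ht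
    rw [hs]
    have h3 := mul_le_mul_of_nonneg_left this hlam.le
    have h4 : lam * cos (arccos (y / lam)) = y := hy'.symm
    calc lam * sin t - y * t ≤ lam * (sin (arccos (y / lam)) +
          (t - arccos (y / lam)) * cos (arccos (y / lam))) - y * t := by linarith
      _ = lam * sin (arccos (y / lam)) + (t - arccos (y / lam)) *
          (lam * cos (arccos (y / lam))) - y * t := by ring
      _ = _ := by rw [h4]; ring

/-- `-arccos (x / lam) / π` is a subgradient of `funG lam` at `x`. -/
lemma funG_sub_le {lam x y : ℝ} (hlam : 0 < lam) (hy : 0 ≤ y) :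
    funG lam x - funG lam y ≤ (y - x) * (arccos (x / lam) / π) := by
  have h := le_funG (t := arccos (x / lam)) hlam hy ⟨arccos_nonneg _, arccos_le_pi _⟩
  have hG : funG lam x = (lam * sin (arccos (x / lam)) - x * arccos (x / lam)) / π := by
    rw [funG_eq hlam, sin_arccos, sqrt_one_sub_div_sq hlam]
    field_simp
  rw [hG]
  have e : (lam * sin (arccos (x / lam)) - y * arccos (x / lam)) / π
      = (lam * sin (arccos (x / lam)) - x * arccos (x / lam)) / π
        - (y - x) * (arccos (x / lam) / π) := by ring
  linarith

lemma funG_antitone {lam x y : ℝ} (hlam : 0 < lam) (hx : 0 ≤ x) (hxy : x ≤ y) :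
    funG lam y ≤ funG lam x := by
  have h := funG_sub_le (x := y) hlam hx
  have : 0 ≤ arccos (y / lam) / π := div_nonneg (arccos_nonneg _) pi_pos.le
  nlinarith

lemma funG_nonneg {lam x : ℝ} (hlam : 0 < lam) (hx : 0 ≤ x) : 0 ≤ funG lam x := by
  have h := le_funG (t := 0) hlam hx ⟨le_rfl, pi_pos.le⟩
  simpa using h

lemma funG_sub_le_half {lam x y : ℝ} (hlam : 0 < lam) (hx : 0 ≤ x) (hxy : x ≤ y) :
    funG lam x - funG lam y ≤ (y - x) / 2 := by
  have h := funG_sub_le (x := x) hlam (hx.trans hxy)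
  have : arccos (x / lam) / π ≤ 1 / 2 := by
    rw [div_le_iff₀ pi_pos]
    have := arccos_le_pi_div_two.2 (div_nonneg hx hlam.le)
    linarith
  nlinarith

lemma arccos_half : arccos (1 / 2) = π / 3 := by
  rw [← cos_pi_div_three]
  exact arccos_cos (by positivity) (by linarith [pi_pos])

lemma funG_sub_le_third {lam x y : ℝ} (hlam : 0 < lam) (hx : lam / 2 ≤ x) (hxy : x ≤ y) :
    funG lam x - funG lam y ≤ (y - x) / 3 := by
  have hx0 : 0 ≤ x := by linarith
  have h := funG_sub_le (x := x) hlam (hx0.trans hxy)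
  have : arccos (x / lam) / π ≤ 1 / 3 := by
    rw [div_le_iff₀ pi_pos]
    have : arccos (x / lam) ≤ arccos (1 / 2) :=
      antitone_arccos (by rw [le_div_iff₀ hlam]; linarith)
    rw [arccos_half] at this
    linarith
  nlinarith

lemma funG_midpoint {lam c u : ℝ} (hlam : 0 < lam) (h1 : 0 ≤ c - u) (h2 : 0 ≤ c + u) :
    2 * funG lam c ≤ funG lam (c - u) + funG lam (c + u) := by
  have a := funG_sub_le (x := c) hlam h1
  have b := funG_sub_le (x := c) hlam h2
  nlinarith

lemma div_ten_le_funG {lam : ℝ} (hlam : 0 < lam) : lam / 10 ≤ funG lam (lam / 2) := by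
  have h := le_funG (t := π / 3) (y := lam / 2) hlam (by positivity)
    ⟨by positivity, by linarith [pi_pos]⟩
  refine le_trans ?_ h
  rw [le_div_iff₀ pi_pos, sin_pi_div_three]
  have h3 : (1.73 : ℝ) ≤ √3 := le_sqrt_of_sq_le (by norm_num)
  have := pi_lt_d2
  nlinarith

lemma sum_unit_layers_le (x : ℝ) (hx : 0 ≤ x) (K : ℕ) :
    ∑ n ∈ Finset.range K, max 0 (min 1 (x - n)) ≤ min x K := by
  induction K with
  | zero => simp [hx]
  | succ k ih =>
    rw [Finset.sum_range_succ]
    push_cast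
    grind

/-- The layer of the subgraph of `funG lam` between the heights `n` and `n + 1` has area at least
`c - a`, where `c` is the point at which `funG lam` takes the middle value `n + 1 / 2`. -/
lemma le_integral_layer {lam a c n : ℝ} (hlam : 0 < lam) (ha : 0 ≤ a) (hac : a ≤ c)
    (hc : c ≤ lam) (hG : funG lam c = n + 1 / 2) :
    c - a ≤ ∫ z in a..(2 * lam), max 0 (min 1 (funG lam z - n)) := by
  set φ : ℝ → ℝ := fun z => max 0 (min 1 (funG lam z - n)) with hφ
  have hcont : Continuous φ := by
    have := continuous_funG hlam
    fun_prop
  have hI : ∀ p q, IntervalIntegrable φ MeasureTheory.volume p q :=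
    fun p q => hcont.intervalIntegrable p q
  have hsub : ∫ z in a..c, φ (2 * c - z) = ∫ z in c..(2 * c - a), φ z := by
    rw [intervalIntegral.integral_comp_sub_left]
    congr 1
    ring
  have hsplit : ∫ z in a..(2 * lam), φ z = (∫ z in a..c, φ z) + (∫ z in c..(2 * c - a), φ z)
      + ∫ z in (2 * c - a)..(2 * lam), φ z := by
    rw [intervalIntegral.integral_add_adjacent_intervals (hI _ _) (hI _ _),
      intervalIntegral.integral_add_adjacent_intervals (hI _ _) (hI _ _)]
  have hnn : 0 ≤ ∫ z in (2 * c - a)..(2 * lam), φ z :=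
    intervalIntegral.integral_nonneg (by linarith) (fun z _ => le_max_left _ _)
  have hI' : IntervalIntegrable (fun z => φ (2 * c - z)) MeasureTheory.volume a c :=
    (hcont.comp (continuous_const.sub continuous_id)).intervalIntegrable _ _
  have hmain : ∫ z in a..c, (1 : ℝ) ≤ ∫ z in a..c, (φ z + φ (2 * c - z)) := by
    apply intervalIntegral.integral_mono_on hac (by simp) ((hI _ _).add hI')
    intro z hz
    have hm := funG_midpoint (c := c) (u := c - z) hlam (by linarith [hz.1])
      (by linarith [hz.1, hz.2])
    have e1 : c - (c - z) = z := by ring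
    have e2 : c + (c - z) = 2 * c - z := by ring
    rw [e1, e2, hG] at hm
    simp only [hφ]
    grind
  rw [intervalIntegral.integral_add (hI _ _) hI', hsub] at hmain
  simp at hmain
  linarith

lemma sum_indicator_lt {j K : ℕ} (h : j ≤ K) :
    ∑ n ∈ Finset.range K, (if n < j then (1 : ℝ) else 0) = j := by
  rw [← Finset.sum_filter]
  have : (Finset.range K).filter (fun n => n < j) = Finset.range j := by
    ext n
    simp
    omega
  simp [this]

lemma layer_count_le {lam : ℝ} (hlam : 0 < lam) {N b : ℤ} (hN0 : 0 ≤ N) (hN : (N : ℝ) ≤ lam / 2)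
    {n : ℕ} (hn : (n : ℤ) < ⌊funG lam N + 1 / 4⌋) :
    ∑ m ∈ Finset.Ioo N b, (if (n : ℤ) < ⌊funG lam m + 1 / 4⌋ then (1 : ℝ) else 0) + 1 / 2
      + 1 / 4 * (if n < ⌊lam / 10⌋.toNat then (1 : ℝ) else 0)
      ≤ ∫ z in (N : ℝ)..(2 * lam), max 0 (min 1 (funG lam z - n)) := by
  have hiff : ∀ m : ℤ, (n : ℤ) < ⌊funG lam m + 1 / 4⌋ → (n : ℝ) + 3 / 4 ≤ funG lam m := by
    intro m hm
    have h1 : (n : ℤ) + 1 ≤ ⌊funG lam m + 1 / 4⌋ := hm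
    rw [Int.le_floor] at h1
    push_cast at h1
    linarith
  have hN0' : (0 : ℝ) ≤ N := by exact_mod_cast hN0
  have hNG := hiff N hn
  obtain ⟨c, ⟨hNc, hcl⟩, hc⟩ : (n : ℝ) + 1 / 2 ∈ funG lam '' Icc (N : ℝ) lam := by
    apply intermediate_value_Icc' (by linarith) (continuous_funG hlam).continuousOn
    rw [funG_of_le hlam le_rfl]
    exact ⟨by positivity, by linarith⟩
  have hI := le_integral_layer hlam hN0' hNc hcl hc
  set g : ℝ := 1 / 4 * (if n < ⌊lam / 10⌋.toNat then (1 : ℝ) else 0) with hg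
  have hpt : ∀ m : ℤ, N ≤ m → (n : ℤ) < ⌊funG lam m + 1 / 4⌋ → (m : ℝ) + 1 / 2 + g ≤ c := by
    intro m hNm hm
    have hmG := hiff m hm
    have hm0 : (0 : ℝ) ≤ m := by exact_mod_cast hN0.trans hNm
    have hmc : (m : ℝ) ≤ c := by
      by_contra! hlt
      have := funG_antitone hlam (hN0'.trans hNc) hlt.le
      linarith
    have hhalf := funG_sub_le_half hlam hm0 hmc
    by_cases hL : n < ⌊lam / 10⌋.toNat
    · simp only [hg, hL, if_true]
      have hL' : ((n : ℤ) + 1) ≤ ⌊lam / 10⌋ := by omega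
      rw [Int.le_floor] at hL'
      push_cast at hL'
      have h10 := div_ten_le_funG hlam
      rcases le_total (lam / 2) m with h | h
      · have := funG_sub_le_third hlam h hmc
        linarith
      · have hc2 : lam / 2 ≤ c := by
          by_contra! hlt
          have := funG_antitone hlam (hN0'.trans hNc) hlt.le
          linarith
        have := funG_sub_le_third hlam le_rfl hc2
        linarith
    · simp only [hg, hL, if_false]
      linarith
  have hcard : ∑ m ∈ Finset.Ioo N b, (if (n : ℤ) < ⌊funG lam m + 1 / 4⌋ then (1 : ℝ) else 0)
      ≤ c - 1 / 2 - g - N := by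
    rw [← Finset.sum_filter, Finset.sum_const, nsmul_eq_mul, mul_one]
    have hsub : (Finset.Ioo N b).filter (fun m : ℤ => (n : ℤ) < ⌊funG lam m + 1 / 4⌋)
        ⊆ Finset.Ioc N ⌊c - 1 / 2 - g⌋ := by
      intro m hm
      rw [Finset.mem_filter, Finset.mem_Ioo] at hm
      rw [Finset.mem_Ioc, Int.le_floor]
      have := hpt m hm.1.1.le hm.2
      exact ⟨hm.1.1, by linarith⟩
    have hle := Finset.card_le_card hsub
    rw [Int.card_Ioc] at hle
    have hNf : N ≤ ⌊c - 1 / 2 - g⌋ := by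
      rw [Int.le_floor]
      have := hpt N le_rfl hn
      linarith
    have hle' : (((Finset.Ioo N b).filter
        (fun m : ℤ => (n : ℤ) < ⌊funG lam m + 1 / 4⌋)).card : ℤ) ≤ ⌊c - 1 / 2 - g⌋ - N := by
      omega
    have hle2 : (((Finset.Ioo N b).filter
        (fun m : ℤ => (n : ℤ) < ⌊funG lam m + 1 / 4⌋)).card : ℝ) ≤ ⌊c - 1 / 2 - g⌋ - N := by
      exact_mod_cast hle'
    have := Int.floor_le (c - 1 / 2 - g)
    linarith
  linarith

lemma trapSum_funG_le {lam : ℝ} (hlam : 0 < lam) {N : ℤ} (hN0 : 0 ≤ N)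
    (hN : (N : ℝ) ≤ lam / 2) :
    trapSum (fun z => funG lam z + 1 / 4) N (⌊lam⌋ + 1) + (⌊lam / 10⌋ : ℝ) / 4
      ≤ ∫ z in (N : ℝ)..lam, funG lam z := by
  have hN0' : (0 : ℝ) ≤ N := by exact_mod_cast hN0
  have hcont := continuous_funG hlam
  have hend : ⌊funG lam ((⌊lam⌋ + 1 : ℤ) : ℝ) + 1 / 4⌋ = 0 := by
    rw [funG_of_le hlam (by push_cast; exact (Int.lt_floor_add_one lam).le)]
    norm_num
  have hf0 : ∀ m : ℤ, N ≤ m → 0 ≤ ⌊funG lam m + 1 / 4⌋ := by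
    intro m hm
    have hm' : (0 : ℝ) ≤ m := by exact_mod_cast hN0.trans hm
    have := funG_nonneg hlam hm'
    exact Int.floor_nonneg.2 (by linarith)
  have hfle : ∀ m : ℤ, N ≤ m → ⌊funG lam m + 1 / 4⌋ ≤ ⌊funG lam N + 1 / 4⌋ := by
    intro m hm
    have hm' : (N : ℝ) ≤ m := by exact_mod_cast hm
    have := funG_antitone hlam hN0' hm'
    exact Int.floor_le_floor (by linarith)
  obtain ⟨K, hK⟩ := Int.eq_ofNat_of_zero_le (hf0 N le_rfl)
  obtain ⟨L, hL⟩ := Int.eq_ofNat_of_zero_le (Int.floor_nonneg.2 (by positivity : 0 ≤ lam / 10))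
  have hLK : L ≤ K := by
    have h1 : ⌊lam / 10⌋ ≤ ⌊funG lam N + 1 / 4⌋ := by
      apply Int.floor_le_floor
      have := div_ten_le_funG hlam
      have := funG_antitone hlam hN0' hN
      linarith
    omega
  have hterm : ∀ m : ℤ, N ≤ m → (⌊funG lam m + 1 / 4⌋ : ℝ) = ∑ n ∈ Finset.range K,
      (if (n : ℤ) < ⌊funG lam m + 1 / 4⌋ then (1 : ℝ) else 0) := by
    intro m hm
    obtain ⟨j, hj⟩ := Int.eq_ofNat_of_zero_le (hf0 m hm)
    have := hfle m hm
    rw [hj] at this ⊢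
    have hjK : j ≤ K := by omega
    simpa using (sum_indicator_lt hjK).symm
  have hT : trapSum (fun z => funG lam z + 1 / 4) N (⌊lam⌋ + 1) + (⌊lam / 10⌋ : ℝ) / 4
      = ∑ n ∈ Finset.range K, (∑ m ∈ Finset.Ioo N (⌊lam⌋ + 1),
        (if (n : ℤ) < ⌊funG lam m + 1 / 4⌋ then (1 : ℝ) else 0) + 1 / 2
        + 1 / 4 * (if n < ⌊lam / 10⌋.toNat then (1 : ℝ) else 0)) := by
    unfold trapSum
    rw [hend, hK, Finset.sum_congr rfl (fun m hm => hterm m (Finset.mem_Ioo.1 hm).1.le),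
      Finset.sum_comm, Finset.sum_add_distrib, Finset.sum_add_distrib, ← Finset.mul_sum, hL,
      Int.toNat_natCast, sum_indicator_lt hLK]
    simp
    ring
  have hI : ∀ n : ℕ, IntervalIntegrable (fun z => max 0 (min 1 (funG lam z - n)))
      MeasureTheory.volume N (2 * lam) := fun n =>
    (by fun_prop : Continuous (fun z => max 0 (min 1 (funG lam z - n)))).intervalIntegrable _ _
  have htail : ∫ z in lam..(2 * lam), funG lam z = 0 := by
    rw [intervalIntegral.integral_congr (g := fun _ => 0)]
    · simp
    · intro z hz
      rw [uIcc_of_le (by linarith)] at hz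
      exact funG_of_le hlam hz.1
  rw [hT]
  calc _ ≤ ∑ n ∈ Finset.range K, ∫ z in (N : ℝ)..(2 * lam), max 0 (min 1 (funG lam z - n)) := by
        apply Finset.sum_le_sum
        intro n hn
        apply layer_count_le hlam hN0 hN
        have := Finset.mem_range.1 hn
        omega
    _ = ∫ z in (N : ℝ)..(2 * lam),
          ∑ n ∈ Finset.range K, max 0 (min 1 (funG lam z - n)) :=
        (intervalIntegral.integral_finsetSum (fun n _ => hI n)).symm
    _ ≤ ∫ z in (N : ℝ)..(2 * lam), funG lam z := by
        apply intervalIntegral.integral_mono_on (by linarith) _ (hcont.intervalIntegrable _ _)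
        · intro z hz
          exact (sum_unit_layers_le _ (funG_nonneg hlam (hN0'.trans hz.1)) K).trans
            (min_le_left _ _)
        · exact (by fun_prop : Continuous (fun z => ∑ n ∈ Finset.range K,
            max 0 (min 1 (funG lam z - n)))).intervalIntegrable _ _
    _ = ∫ z in (N : ℝ)..lam, funG lam z := by
        rw [← intervalIntegral.integral_add_adjacent_intervals
          (hcont.intervalIntegrable N lam) (hcont.intervalIntegrable _ _), htail, add_zero]

lemma hasDerivAt_funG {lam z : ℝ} (hlam : 0 < lam) (h0 : 0 < z) (hz : z < lam) :
    HasDerivAt (funG lam) (-arccos (z / lam) / π) z := by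
  have hfun : funG lam = fun z => (√(lam ^ 2 - z ^ 2) - z * arccos (z / lam)) / π :=
    funext (funG_eq hlam)
  rw [hfun]
  have hpos : 0 < lam ^ 2 - z ^ 2 := by nlinarith
  have hlt : z / lam < 1 := (div_lt_one hlam).2 hz
  have hgt : -1 < z / lam := by linarith [div_pos h0 hlam]
  have h1 := (((hasDerivAt_id z).pow 2).const_sub (lam ^ 2)).sqrt (by simpa using hpos.ne')
  have h2 := (hasDerivAt_arccos hgt.ne' hlt.ne).comp z ((hasDerivAt_id z).div_const lam)
  have h3 := (h1.sub ((hasDerivAt_id z).mul h2)).div_const π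
  have hsp : 0 < √(lam ^ 2 - z ^ 2) := sqrt_pos.2 hpos
  refine h3.congr_deriv ?_
  simp only [id, Function.comp, Pi.pow_apply, sqrt_one_sub_div_sq hlam]
  field_simp
  ring

lemma concaveOn_funPhi {lam mu : ℝ} (hmu : 0 < mu) (h : mu ≤ lam) :
    ConcaveOn ℝ (Icc 0 mu) (funPhi lam mu) := by
  have hlam : 0 < lam := hmu.trans_le h
  have hd : ∀ z ∈ Ioo 0 mu, HasDerivAt (funPhi lam mu)
      (-arccos (z / lam) / π - -arccos (z / mu) / π) z := fun z hz =>
    (hasDerivAt_funG hlam hz.1 (hz.2.trans_le h)).sub (hasDerivAt_funG hmu hz.1 hz.2)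
  apply AntitoneOn.concaveOn_of_deriv (convex_Icc _ _)
  · exact ((continuous_funG hlam).sub (continuous_funG hmu)).continuousOn
  · rw [interior_Icc]
    exact fun z hz => (hd z hz).differentiableAt.differentiableWithinAt
  · rw [interior_Icc]
    have hd2 : ∀ z ∈ Ioo 0 mu, HasDerivAt
        (fun z => -arccos (z / lam) / π - -arccos (z / mu) / π)
        ((1 / √(lam ^ 2 - z ^ 2) - 1 / √(mu ^ 2 - z ^ 2)) / π) z := by
      intro z hz
      have key : ∀ l : ℝ, mu ≤ l → HasDerivAt (fun z => -arccos (z / l) / π)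
          (1 / √(l ^ 2 - z ^ 2) / π) z := by
        intro l hl
        have hl0 : 0 < l := hmu.trans_le hl
        have hpos : 0 < l ^ 2 - z ^ 2 := by nlinarith [hz.1, hz.2]
        have hlt : z / l < 1 := (div_lt_one hl0).2 (hz.2.trans_le hl)
        have hgt : -1 < z / l := by linarith [div_pos hz.1 hl0]
        have h2 := (((hasDerivAt_arccos hgt.ne' hlt.ne).comp z
          ((hasDerivAt_id z).div_const l)).neg).div_const π
        refine h2.congr_deriv ?_
        have hsp : 0 < √(l ^ 2 - z ^ 2) := sqrt_pos.2 hpos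
        rw [sqrt_one_sub_div_sq hl0]
        field_simp
      exact ((key lam h).sub (key mu le_rfl)).congr_deriv (by ring)
    have hanti : AntitoneOn (fun z => -arccos (z / lam) / π - -arccos (z / mu) / π)
        (Ioo 0 mu) := by
      apply antitoneOn_of_deriv_nonpos (convex_Ioo _ _)
      · exact fun z hz => (hd2 z hz).continuousAt.continuousWithinAt
      · rw [interior_Ioo]
        exact fun z hz => (hd2 z hz).differentiableAt.differentiableWithinAt
      · rw [interior_Ioo]
        intro z hz
        rw [(hd2 z hz).deriv]
        apply div_nonpos_of_nonpos_of_nonneg _ pi_pos.le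
        have hpos : 0 < mu ^ 2 - z ^ 2 := by nlinarith [hz.1, hz.2]
        have : 1 / √(lam ^ 2 - z ^ 2) ≤ 1 / √(mu ^ 2 - z ^ 2) :=
          one_div_le_one_div_of_le (sqrt_pos.2 hpos) (sqrt_le_sqrt (by nlinarith))
        linarith
    exact hanti.congr (fun z hz => (hd z hz).deriv.symm)

lemma ConcaveOn.trapezoid_le_integral {g : ℝ → ℝ} {a : ℝ} (hg : ConcaveOn ℝ (Icc a (a + 1)) g)
    (hc : Continuous g) : (g a + g (a + 1)) / 2 ≤ ∫ z in a..(a + 1), g z := by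
  have h : ∫ z in a..(a + 1), (g a + (g (a + 1) - g a) * (z - a)) ≤ ∫ z in a..(a + 1), g z := by
    apply intervalIntegral.integral_mono_on (by linarith)
      (Continuous.intervalIntegrable (by fun_prop) _ _) (hc.intervalIntegrable _ _)
    intro z hz
    have := hg.2 (left_mem_Icc.2 (by linarith)) (right_mem_Icc.2 (by linarith))
      (by linarith [hz.2] : 0 ≤ a + 1 - z) (by linarith [hz.1] : 0 ≤ z - a) (by ring)
    simp only [smul_eq_mul] at this
    have e : (a + 1 - z) * a + (z - a) * (a + 1) = z := by ring
    rw [e] at this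
    linarith
  have e : ∫ z in a..(a + 1), (g a + (g (a + 1) - g a) * (z - a)) = (g a + g (a + 1)) / 2 := by
    rw [intervalIntegral.integral_add (by simp) (Continuous.intervalIntegrable (by fun_prop) _ _),
      intervalIntegral.integral_const_mul, intervalIntegral.integral_sub (by simp) (by simp)]
    simp
    ring
  linarith

lemma trapSum_succ (g : ℝ → ℝ) {a b : ℤ} (h : a < b) :
    trapSum g a (b + 1) = trapSum g a b + ((⌊g b⌋ : ℝ) + ⌊g (b + 1)⌋) / 2 := by
  unfold trapSum
  have : Finset.Ioo a (b + 1) = insert b (Finset.Ioo a b) := by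
    ext m
    simp
    omega
  rw [this, Finset.sum_insert (by simp)]
  push_cast
  ring

lemma trapSum_le_of_concaveOn {g : ℝ → ℝ} {a b : ℤ} (hab : a < b)
    (hg : ConcaveOn ℝ (Icc (a : ℝ) b) g) (hc : Continuous g) :
    trapSum (fun z => g z + 1 / 4) a b ≤ (∫ z in (a : ℝ)..b, g z) + ((b : ℝ) - a) / 4 := by
  have step : ∀ x y : ℝ, ((⌊x + 1 / 4⌋ : ℝ) + ⌊y + 1 / 4⌋) / 2 ≤ (x + y) / 2 + 1 / 4 := by
    intro x y
    have := Int.floor_le (x + 1 / 4)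
    have := Int.floor_le (y + 1 / 4)
    linarith
  have hab' : a + 1 ≤ b := hab
  induction b, hab' using Int.leInduction with
  | base =>
    have h1 := step (g a) (g (a + 1))
    push_cast at hg ⊢
    have h2 := hg.trapezoid_le_integral hc
    have h3 : Finset.Ioo a (a + 1) = ∅ := by
      ext m
      simp
    simp only [trapSum, h3, Finset.sum_empty]
    push_cast
    linarith
  | succ k hk ih =>
    have hak : a < k := hk
    have hak' : (a : ℝ) ≤ k := by exact_mod_cast hak.le
    push_cast at hg ⊢
    have h0 := ih hak (hg.subset (Icc_subset_Icc le_rfl (by linarith)) (convex_Icc _ _))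
    have h1 := step (g k) (g (k + 1))
    have h2 := (hg.subset (Icc_subset_Icc hak' le_rfl)
      (convex_Icc _ _)).trapezoid_le_integral hc
    rw [trapSum_succ _ hak, ← intervalIntegral.integral_add_adjacent_intervals
      (hc.intervalIntegrable a k) (hc.intervalIntegrable _ _)]
    linarith

lemma arccos_le_mul_sqrt {t : ℝ} (h0 : 0 ≤ t) (h1 : t ≤ 1) : arccos t ≤ π / 2 * √(1 - t) := by
  set θ := arccos t with hθ
  have hθ0 : 0 ≤ θ := arccos_nonneg _
  have hθ1 : θ ≤ π / 2 := arccos_le_pi_div_two.2 h0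
  have hpi := pi_pos
  have ht : 1 - t = 2 * sin (θ / 2) ^ 2 := by
    have hcos : cos θ = t := cos_arccos (by linarith) h1
    have h2 := cos_two_mul (θ / 2)
    have h3 := sin_sq_add_cos_sq (θ / 2)
    rw [mul_div_cancel₀ θ two_ne_zero, hcos] at h2
    linarith
  have hsin : θ / π * √2 ≤ sin (θ / 2) := by
    have h := strictConcaveOn_sin_Icc.concaveOn.2
      (left_mem_Icc.2 hpi.le) (⟨by positivity, by linarith⟩ : π / 4 ∈ Icc 0 π)
      (by rw [sub_nonneg, div_le_one hpi]; linarith : 0 ≤ 1 - 2 * θ / π)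
      (by positivity : 0 ≤ 2 * θ / π) (by ring)
    simp only [smul_eq_mul, sin_zero, mul_zero, zero_add, sin_pi_div_four] at h
    have e : 2 * θ / π * (π / 4) = θ / 2 := by
      field_simp
      ring
    rw [e] at h
    linarith [h, (by ring : 2 * θ / π * (√2 / 2) = θ / π * √2)]
  rw [ht, sqrt_mul (by norm_num), sqrt_sq (by
    exact sin_nonneg_of_nonneg_of_le_pi (by positivity) (by linarith))]
  have hsq : √2 * √2 = 2 := mul_self_sqrt (by norm_num)
  calc θ = π / 2 * (√2 * (θ / π * √2)) := by
        rw [show π / 2 * (√2 * (θ / π * √2)) = π / 2 * (θ / π) * (√2 * √2) by ring, hsq]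
        field_simp
    _ ≤ _ := by gcongr

lemma funG_le_rpow {mu z : ℝ} (hmu : 0 < mu) (hz : z ∈ Icc 0 mu) :
    funG mu z ≤ (mu - z) ^ (3 / 2 : ℝ) / (3 * √mu) := by
  have hanti : AntitoneOn (fun z => (mu - z) ^ (3 / 2 : ℝ) / (3 * √mu) - funG mu z)
      (Icc 0 mu) := by
    have hd : ∀ z ∈ Ioo 0 mu, HasDerivAt
        (fun z => (mu - z) ^ (3 / 2 : ℝ) / (3 * √mu) - funG mu z)
        (-(√(mu - z) / (2 * √mu)) + arccos (z / mu) / π) z := by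
      intro z hz
      have h1 := ((((hasDerivAt_id z).const_sub mu).rpow_const (p := 3 / 2)
        (Or.inl (by simpa using (sub_pos.2 hz.2).ne'))).div_const (3 * √mu)).sub
        (hasDerivAt_funG hmu hz.1 hz.2)
      refine h1.congr_deriv ?_
      rw [sqrt_eq_rpow (mu - z)]
      norm_num
      field_simp
      ring
    apply antitoneOn_of_deriv_nonpos (convex_Icc _ _)
    · have h1 : Continuous (fun z : ℝ => (mu - z) ^ (3 / 2 : ℝ)) :=
        (continuous_const.sub continuous_id).rpow_const (fun _ => Or.inr (by norm_num))
      exact ((h1.div_const _).sub (continuous_funG hmu)).continuousOn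
    · rw [interior_Icc]
      exact fun z hz => (hd z hz).differentiableAt.differentiableWithinAt
    · rw [interior_Icc]
      intro z hz
      rw [(hd z hz).deriv]
      have h := arccos_le_mul_sqrt (div_nonneg hz.1.le hmu.le) ((div_le_one hmu).2 hz.2.le)
      have e : 1 - z / mu = (mu - z) / mu := by field_simp
      rw [e, sqrt_div (sub_pos.2 hz.2).le] at h
      have h2 : arccos (z / mu) / π ≤ √(mu - z) / (2 * √mu) := by
        rw [div_le_iff₀ pi_pos]
        calc _ ≤ _ := h
          _ = _ := by ring
      linarith
  have h := hanti hz ⟨hmu.le, le_rfl⟩ hz.2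
  simp only [sub_self, funG_of_le hmu le_rfl] at h
  rw [zero_rpow (by norm_num)] at h
  simp at h
  linarith

lemma integral_funG_lt {mu a : ℝ} (hmu : 0 < mu) (ha : 0 ≤ a) (ham : a ≤ mu) (h1 : mu < a + 1) :
    ∫ z in a..mu, funG mu z < 2 / (15 * √mu) := by
  have hs : 0 < √mu := sqrt_pos.2 hmu
  have hc : Continuous (fun z : ℝ => (mu - z) ^ (3 / 2 : ℝ) / (3 * √mu)) :=
    ((continuous_const.sub continuous_id).rpow_const (fun _ => Or.inr (by norm_num))).div_const _
  have h := intervalIntegral.integral_mono_on (μ := MeasureTheory.volume) ham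
    ((continuous_funG hmu).intervalIntegrable _ _) (hc.intervalIntegrable _ _)
    (fun z hz => funG_le_rpow hmu ⟨ha.trans hz.1, hz.2⟩)
  refine h.trans_lt ?_
  rw [intervalIntegral.integral_div,
    intervalIntegral.integral_comp_sub_left (fun x : ℝ => x ^ (3 / 2 : ℝ)),
    integral_rpow (Or.inl (by norm_num)), sub_self, zero_rpow (by norm_num)]
  have hlt : (mu - a) ^ (3 / 2 + 1 : ℝ) < 1 :=
    rpow_lt_one (by linarith) (by linarith) (by norm_num)
  rw [div_lt_div_iff₀ (by positivity) (by positivity)]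
  norm_num at hlt ⊢
  nlinarith

theorem regionIV_bound (lam mu : ℝ) (hlam : 0 < lam) (hmu1 : 1 ≤ mu) (hmu2 : mu ≤ lam / 2) :
    (∫ z in (0 : ℝ)..mu, funPhi lam mu z) + (∫ z in mu..lam, funG lam z) -
        trapSum (fun z => funPhi lam mu z + 1 / 4) 0 ⌊mu⌋ -
        trapSum (fun z => funG lam z + 1 / 4) ⌊mu⌋ (⌊lam⌋ + 1) >
      (1 / 4) * ((⌊lam / 10⌋ : ℝ) - (⌊mu⌋ : ℝ) - 8 / (15 * Real.sqrt mu)) := by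
  have hmu : 0 < mu := by linarith
  have hN1 : 1 ≤ ⌊mu⌋ := Int.le_floor.2 (by simpa using hmu1)
  have hNmu : (⌊mu⌋ : ℝ) ≤ mu := Int.floor_le mu
  have hN0 : (0 : ℝ) ≤ ⌊mu⌋ := by exact_mod_cast (by omega : (0 : ℤ) ≤ ⌊mu⌋)
  have hcl := continuous_funG hlam
  have hcm := continuous_funG hmu
  have hcP : Continuous (funPhi lam mu) := hcl.sub hcm
  have hT1 := trapSum_le_of_concaveOn (a := 0) (b := ⌊mu⌋) (by omega)
    ((concaveOn_funPhi hmu (by linarith : mu ≤ lam)).subset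
      (Icc_subset_Icc (by simp) hNmu) (convex_Icc _ _)) hcP
  have hT2 := trapSum_funG_le hlam (N := ⌊mu⌋) (by omega) (by linarith)
  have hG := integral_funG_lt hmu hN0 hNmu (Int.lt_floor_add_one mu)
  have e1 := intervalIntegral.integral_add_adjacent_intervals
    (hcP.intervalIntegrable (μ := MeasureTheory.volume) 0 ⌊mu⌋) (hcP.intervalIntegrable _ mu)
  have e2 := intervalIntegral.integral_add_adjacent_intervals
    (hcl.intervalIntegrable (μ := MeasureTheory.volume) ⌊mu⌋ mu) (hcl.intervalIntegrable _ lam)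
  have e3 : ∫ z in (⌊mu⌋ : ℝ)..mu, funPhi lam mu z
      = (∫ z in (⌊mu⌋ : ℝ)..mu, funG lam z) - ∫ z in (⌊mu⌋ : ℝ)..mu, funG mu z :=
    intervalIntegral.integral_sub (hcl.intervalIntegrable _ _) (hcm.intervalIntegrable _ _)
  have e4 : 1 / 4 * (8 / (15 * √mu)) = 2 / (15 * √mu) := by ring
  push_cast at hT1
  rw [mul_sub, mul_sub, e4]
  linarith
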